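/- arXiv:2112.04965 — 2 statements merged into one kernel-verified Lean document; each statement's English description precedes it below -/
import Mathlib

section
/- Let n ≥ 1, m ≥ 1, let S be a set of permutations of Fin n containing the identity, and let G be the subgroup of the symmetric group on Fin n generated by S. The player can win the (S, m)-game if and only if |G| = 1, or m = 1, or there exist a prime p and positive integers a, b with |G| = p^a and m = p^b. -/
/-- The state of the (n, m) rotation game after `k` turns: `s₀` is the initial
configuration, `y k` is the move added on turn `k+1`, and `r k` is the rotation
applied after that move. -/
def rotState {n m : ℕ} (y : ℕ → Fin n → ZMod m) (r : ℕ → Fin n)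
    (s₀ : Fin n → ZMod m) : ℕ → Fin n → ZMod m
  | 0 => s₀
  | k + 1 => fun i => (rotState y r s₀ k + y k) (i + r k)

/-- The first `N` moves of `y` form a winning sequence for the (n, m) rotation game. -/
def RotWinning (n m N : ℕ) (y : ℕ → Fin n → ZMod m) : Prop :=
  ∀ (s₀ : Fin n → ZMod m) (r : ℕ → Fin n), ∃ k ≤ N, rotState y r s₀ k = 0

/-- The player can win the (n, m) rotation game. -/
def RotCanWin (n m : ℕ) : Prop := ∃ N y, RotWinning n m N y

/-- The state of the permutation game after `k` turns: `s₀` is the initial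
configuration, `y k` is the move added on turn `k+1`, and `σ k` is the
permutation applied after that move (`(σ • x) i = x (σ⁻¹ i)`). -/
def permState {n m : ℕ} (y : ℕ → Fin n → ZMod m) (σ : ℕ → Equiv.Perm (Fin n))
    (s₀ : Fin n → ZMod m) : ℕ → Fin n → ZMod m
  | 0 => s₀
  | k + 1 => fun i => (permState y σ s₀ k + y k) ((σ k)⁻¹ i)

/-- The player can win the (S, m) permutation game: some finite sequence of
moves reaches the zero configuration against every initial configuration and
every sequence of permutations drawn from `S`. -/
def PermCanWin {n : ℕ} (S : Set (Equiv.Perm (Fin n))) (m : ℕ) : Prop :=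
  ∃ (N : ℕ) (y : ℕ → Fin n → ZMod m),
    ∀ (s₀ : Fin n → ZMod m) (σ : ℕ → Equiv.Perm (Fin n)),
      (∀ k, σ k ∈ S) → ∃ k ≤ N, permState y σ s₀ k = 0

section GroupGame

variable {G M : Type*} [Group G] [AddCommGroup M] [DistribMulAction G M]

/-- Playing the moves `l` from the state `s`, the player reaches `0` however the adversary
chooses the group elements from `S`. -/
def Forces (S : Set G) : List M → M → Prop
  | [], s => s = 0
  | y :: l, s => s = 0 ∨ ∀ g ∈ S, Forces S l (g • (s + y))

/-- The player can win the game in which the adversary acts on `M` by elements of `S`. -/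
def GroupCanWin (M : Type*) [AddCommGroup M] [DistribMulAction G M] (S : Set G) : Prop :=
  ∃ l : List M, ∀ s, Forces S l s

theorem Forces.mono {S T : Set G} (h : S ⊆ T) {l : List M} {s : M} (hl : Forces T l s) :
    Forces S l s := by
  induction l generalizing s with
  | nil => exact hl
  | cons y l ih => exact hl.imp_right fun hl g hg => ih (hl g (h hg))

theorem GroupCanWin.mono {S T : Set G} (h : S ⊆ T) (hT : GroupCanWin M T) : GroupCanWin M S :=
  hT.imp fun _ hl s => (hl s).mono h

theorem Forces.append_right {S : Set G} {l : List M} {s : M} (hl : Forces S l s) (l' : List M) :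
    Forces S (l ++ l') s := by
  induction l generalizing s with
  | nil =>
    cases l' with
    | nil => exact hl
    | cons => exact Or.inl hl
  | cons y l ih => exact hl.imp_right fun hl g hg => ih (hl g hg)

/-- If the moves of `l` preserve the set `P`, then playing `l` before `l'` is harmless on `P`. -/
theorem Forces.append_left {S : Set G} {P : Set M} {l l' : List M}
    (hP : ∀ y ∈ l, ∀ s ∈ P, ∀ g ∈ S, g • (s + y) ∈ P) (hl' : ∀ s ∈ P, Forces S l' s)
    {s : M} (hs : s ∈ P) : Forces S (l ++ l') s := by
  induction l generalizing s with
  | nil => exact hl' s hs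
  | cons y l ih =>
    exact Or.inr fun g hg => ih (fun y hy => hP y (List.mem_cons_of_mem _ hy))
      (hP y List.mem_cons_self s hs g hg)

/-- The elements of `M` whose class modulo `A` is fixed by `S`. -/
def fixedModulo (S : Set G) (A : AddSubgroup M) : AddSubgroup M where
  carrier := {x | ∀ g ∈ S, g • x - x ∈ A}
  zero_mem' g _ := by simp
  add_mem' {x y} hx hy g hg := by
    have := A.add_mem (hx g hg) (hy g hg)
    rwa [sub_add_sub_comm, ← smul_add] at this
  neg_mem' {x} hx g hg := by
    have := A.neg_mem (hx g hg)
    rwa [neg_sub', ← smul_neg] at this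

theorem le_fixedModulo {S : Set G} {A : AddSubgroup M} (hA : ∀ g ∈ S, ∀ x ∈ A, g • x ∈ A) :
    A ≤ fixedModulo S A :=
  fun x hx g hg => A.sub_mem (hA g hg x hx) hx

theorem smul_mem_fixedModulo {S : Set G} {A : AddSubgroup M}
    (hA : ∀ g ∈ S, ∀ x ∈ A, g • x ∈ A) {g : G} (hg : g ∈ S) {x : M}
    (hx : x ∈ fixedModulo S A) : g • x ∈ fixedModulo S A := by
  rw [← sub_add_cancel (g • x) x]
  exact add_mem (le_fixedModulo hA (hx g hg)) hx

theorem fixedModulo_closure {S : Set G} {A : AddSubgroup M}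
    (hA : ∀ g ∈ Subgroup.closure S, ∀ x ∈ A, g • x ∈ A) :
    fixedModulo (Subgroup.closure S : Set G) A = fixedModulo S A := by
  refine le_antisymm (fun x hx g hg => hx g (Subgroup.subset_closure hg)) fun x hx g hg => ?_
  induction (hg : g ∈ Subgroup.closure S) using Subgroup.closure_induction with
  | mem g hg => exact hx g hg
  | one => simp
  | mul g h hg _ ihg ihh =>
    have := A.add_mem (hA g hg _ ihh) ihg
    rwa [smul_sub, ← mul_smul, sub_add_sub_cancel] at this
  | inv g hg ih =>
    have := A.neg_mem (hA _ (inv_mem hg) _ ih)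
    rwa [smul_sub, inv_smul_smul, neg_sub] at this

/-- A winning sequence on `A` extends to one that wins from finitely many cosets of `A` on which
`S` acts trivially. -/
theorem exists_forces_cosets {S : Set G} {A : AddSubgroup M}
    (hA : ∀ g ∈ S, ∀ x ∈ A, g • x ∈ A) {l : List M} (hlA : ∀ y ∈ l, y ∈ A)
    (hl : ∀ s ∈ A, Forces S l s) (T : List M) (hT : ∀ t ∈ T, t ∈ fixedModulo S A) :
    ∃ l' : List M, (∀ y ∈ l', y ∈ fixedModulo S A) ∧
      ∀ s, (∃ t ∈ T, s - t ∈ A) → Forces S l' s := by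
  induction hk : T.length generalizing T with
  | zero => exact ⟨[], by simp, by simp_all⟩
  | succ k ih =>
    obtain _ | ⟨t, T⟩ := T
    · simp at hk
    have ht : t ∈ fixedModulo S A := hT t List.mem_cons_self
    have hT' : ∀ u ∈ T, u ∈ fixedModulo S A := fun u hu => hT u (List.mem_cons_of_mem _ hu)
    obtain ⟨l', hl', hw⟩ := ih (T.map (· - t))
      (by simpa using fun u hu => sub_mem (hT' u hu) ht) (by simpa using hk)
    refine ⟨-t :: (l ++ l'), ?_, ?_⟩
    · simp only [List.mem_cons, List.mem_append]
      rintro y (rfl | hy | hy)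
      · exact neg_mem ht
      · exact le_fixedModulo hA (hlA y hy)
      · exact hl' y hy
    rintro s ⟨u, hu, hsu⟩
    refine Or.inr fun g hg => ?_
    rw [← sub_eq_add_neg]
    obtain rfl | hu := List.mem_cons.1 hu
    · exact (hl _ (hA g hg _ hsu)).append_right _
    have key : ∀ h ∈ S, ∀ x, x - (u - t) ∈ A → h • x - (u - t) ∈ A := fun h hh x hx => by
      have := A.add_mem (hA h hh _ hx) (sub_mem (hT' u hu) ht h hh)
      rwa [← sub_add_sub_cancel _ (h • (u - t)), ← smul_sub]
    refine Forces.append_left (P := {x | x - (u - t) ∈ A}) (fun y hy x hx h hh => ?_)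
      (fun x hx => hw x ⟨u - t, List.mem_map_of_mem hu, hx⟩) (key g hg _ (by simpa using hsu))
    refine key h hh _ ?_
    rw [add_sub_right_comm]
    exact A.add_mem hx (hlA y hy)

/-- The player can win if and only if every proper invariant subgroup `A` has a nonzero fixed
point in the quotient by `A`. -/
theorem groupCanWin_iff [Finite M] {S : Set G} (hS : 1 ∈ S) :
    GroupCanWin M S ↔ ∀ A : AddSubgroup M, (∀ g ∈ S, ∀ x ∈ A, g • x ∈ A) → A ≠ ⊤ →
      ∃ x ∉ A, x ∈ fixedModulo S A := by
  constructor
  · rintro ⟨l, hl⟩ A hinv hA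
    by_contra! h
    suffices ∀ l : List M, ∃ s ∉ A, ¬ Forces S l s by
      obtain ⟨s, -, hs⟩ := this l
      exact hs (hl s)
    intro l
    induction l with
    | nil =>
      obtain ⟨x, hx⟩ : ∃ x, x ∉ A := by
        by_contra! hx
        exact hA ((AddSubgroup.eq_top_iff' A).2 hx)
      exact ⟨x, hx, fun h0 => hx (h0 ▸ A.zero_mem)⟩
    | cons y l ih =>
      obtain ⟨z, hz, hzl⟩ := ih
      obtain ⟨g, hg, hgz⟩ : ∃ g ∈ S, g⁻¹ • z - y ∉ A := by
        by_contra! hy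
        refine h z hz fun g hg => ?_
        have hz1 := hinv g hg _ (A.sub_mem (hy g hg) (hy 1 hS))
        rwa [inv_one, one_smul, sub_sub_sub_cancel_right, smul_sub, smul_inv_smul,
          ← neg_sub, A.neg_mem_iff] at hz1
      refine ⟨g⁻¹ • z - y, hgz, ?_⟩
      rintro (h0 | hf)
      · exact hgz (h0 ▸ A.zero_mem)
      · exact hzl (by simpa using hf g hg)
  · intro h
    obtain ⟨A, ⟨⟨hA, l, hlA, hl⟩, hmax⟩⟩ := (Set.toFinite {A : AddSubgroup M |
      (∀ g ∈ S, ∀ x ∈ A, g • x ∈ A) ∧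
        ∃ l : List M, (∀ y ∈ l, y ∈ A) ∧ ∀ s ∈ A, Forces S l s}).exists_maximal
      ⟨⊥, by simp, [], by simp, fun s hs => hs⟩
    by_cases hAtop : A = ⊤
    · exact ⟨l, fun s => hl s (hAtop ▸ AddSubgroup.mem_top s)⟩
    obtain ⟨x, hxA, hx⟩ := h A hA hAtop
    have := Fintype.ofFinite (fixedModulo S A)
    obtain ⟨l', hl', hw⟩ := exists_forces_cosets hA hlA hl
      ((Finset.univ : Finset (fixedModulo S A)).toList.map (↑)) (by simp)
    refine absurd (hmax ⟨fun g hg x hx => smul_mem_fixedModulo hA hg hx, l', hl',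
      fun s hs => hw s ⟨s, by simpa using hs, by simp⟩⟩ (le_fixedModulo hA) hx) hxA

/-- The player can win when a `p`-group acts on a finite abelian `p`-group. -/
theorem groupCanWin_of_isPGroup [Finite M] {p : ℕ} [Fact p.Prime] (H : Subgroup G)
    (hH : IsPGroup p H) (hM : IsPGroup p (Multiplicative M)) : GroupCanWin M (H : Set G) := by
  refine (groupCanWin_iff H.one_mem).2 fun A hA hAtop => ?_
  let _ : MulAction H (M ⧸ A) :=
    { smul g := QuotientAddGroup.map A A (DistribSMul.toAddMonoidHom M (g : G))
        fun x hx => hA g g.2 x hx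
      one_smul := by
        rintro ⟨x⟩
        exact congrArg (QuotientAddGroup.mk (s := A)) (one_smul H x)
      mul_smul := by
        rintro g h ⟨x⟩
        exact congrArg (QuotientAddGroup.mk (s := A)) (mul_smul g h x) }
  have hcard : p ∣ Nat.card (M ⧸ A) := by
    obtain ⟨k, hk⟩ := IsPGroup.iff_card.1 hM
    obtain ⟨j, -, hj⟩ := (Nat.dvd_prime_pow Fact.out).1 (hk ▸ A.index_dvd_card)
    rw [← AddSubgroup.index_eq_card, hj]
    refine dvd_pow_self p fun hj0 => hAtop ?_
    rw [← AddSubgroup.index_eq_one, hj, hj0, pow_zero]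
  obtain ⟨b, hb, hb0⟩ := hH.exists_fixed_point_of_prime_dvd_card_of_fixed_point (M ⧸ A) hcard
    (a := 0) fun g => map_zero (QuotientAddGroup.map A A _ _)
  obtain ⟨x, rfl⟩ := QuotientAddGroup.mk_surjective b
  refine ⟨x, fun hx => hb0 ((QuotientAddGroup.eq_zero_iff x).2 hx).symm, fun g hg => ?_⟩
  rw [← neg_sub, A.neg_mem_iff, ← QuotientAddGroup.eq_zero_iff, QuotientAddGroup.mk_sub,
    sub_eq_zero]
  exact (hb ⟨g, hg⟩).symm

/-- If the player can win, an element of the generated group with `g ^ q = 1` fixes the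
`p`-torsion of `M` whenever `p` and `q` are coprime. -/
theorem GroupCanWin.smul_eq_of_coprime [Finite M] {S : Set G} (hS : 1 ∈ S)
    (hwin : GroupCanWin M S) {p q : ℕ} (hpq : p.Coprime q) {g : G}
    (hg : g ∈ Subgroup.closure S) (hgq : g ^ q = 1) {x : M} (hx : p • x = 0) : g • x = x := by
  set H := Subgroup.closure S
  obtain ⟨A, ⟨⟨hA, hfix⟩, hmax⟩⟩ := (Set.toFinite {A : AddSubgroup M |
    (∀ h ∈ H, ∀ x ∈ A, h • x ∈ A) ∧ ∀ x ∈ A, p • x = 0 → g • x = x}).exists_maximal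
    ⟨⊥, by simp, by simp⟩
  suffices A = ⊤ from hfix x (this ▸ AddSubgroup.mem_top x) hx
  by_contra hAtop
  obtain ⟨z, hzA, hz⟩ := (groupCanWin_iff hS).1 hwin A
    (fun h hh => hA h (Subgroup.subset_closure hh)) hAtop
  rw [← fixedModulo_closure hA] at hz
  refine hzA (hmax ⟨fun h hh y hy => smul_mem_fixedModulo hA hh hy, fun y hy hpy => ?_⟩
    (le_fixedModulo hA) hz)
  set a := g • y - y with ha
  have hpa : p • a = 0 := by rw [ha, smul_sub, smul_comm, hpy, smul_zero, sub_zero]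
  have hga : g • a = a := hfix a (hy g hg) hpa
  have hgy : g • y = y + a := by rw [ha, add_sub_cancel]
  have hpow : ∀ k : ℕ, g ^ k • y = y + k • a := by
    intro k
    induction k with
    | zero => simp
    | succ k ih => rw [pow_succ', mul_smul, ih, smul_add, smul_comm, hga, hgy, succ_nsmul]; abel
  have hqa : q • a = 0 := by simpa [hgq] using hpow q
  have : a = 0 := by
    rw [← AddMonoid.addOrderOf_eq_one_iff]
    exact Nat.eq_one_of_dvd_coprimes hpq (addOrderOf_dvd_of_nsmul_eq_zero hpa)
      (addOrderOf_dvd_of_nsmul_eq_zero hqa)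
  rw [hgy, this, add_zero]

end GroupGame

section PermGame

variable {n m : ℕ}

/-- The action of permutations on configurations. -/
abbrev permAction (n m : ℕ) : DistribMulAction (Equiv.Perm (Fin n)) (Fin n → ZMod m) where
  smul σ x i := x (σ⁻¹ i)
  one_smul _ := rfl
  mul_smul _ _ _ := rfl
  smul_zero _ := rfl
  smul_add _ _ _ := rfl

attribute [local instance] permAction

theorem permState_succ (y : ℕ → Fin n → ZMod m) (σ : ℕ → Equiv.Perm (Fin n))
    (s : Fin n → ZMod m) (k : ℕ) :
    permState y σ s (k + 1) =
      permState (fun i => y (i + 1)) (fun i => σ (i + 1)) (σ 0 • (s + y 0)) k := by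
  induction k with
  | zero => rfl
  | succ k ih => rw [permState, ih]; rfl

theorem forces_ofFn_iff {S : Set (Equiv.Perm (Fin n))} (hS : 1 ∈ S) (N : ℕ)
    (y : ℕ → Fin n → ZMod m) (s : Fin n → ZMod m) :
    Forces S (List.ofFn fun k : Fin N => y k) s ↔
      ∀ σ : ℕ → Equiv.Perm (Fin n), (∀ k, σ k ∈ S) → ∃ k ≤ N, permState y σ s k = 0 := by
  induction N generalizing y s with
  | zero =>
    simp only [List.ofFn_zero, Forces, Nat.le_zero, exists_eq_left, permState]
    exact ⟨fun h _ _ => h, fun h => h (fun _ => 1) fun _ => hS⟩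
  | succ N ih =>
    rw [List.ofFn_succ]
    have ih' := ih fun i => y (i + 1)
    simp only [Forces, Fin.val_zero, Fin.val_succ, ih']
    constructor
    · rintro (h0 | h) σ hσ
      · exact ⟨0, Nat.zero_le _, h0⟩
      · obtain ⟨k, hk, hk0⟩ := h (σ 0) (hσ 0) (fun i => σ (i + 1)) fun i => hσ (i + 1)
        exact ⟨k + 1, Nat.succ_le_succ hk, by rw [permState_succ, hk0]⟩
    · refine fun h => or_iff_not_imp_left.2 fun hs g hg σ hσ => ?_
      obtain ⟨_ | k, hk, hk0⟩ := h (fun i => Nat.casesOn i g σ)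
        (by rintro (_ | i); exacts [hg, hσ i])
      · exact absurd hk0 hs
      · exact ⟨k, Nat.le_of_succ_le_succ hk, by rwa [permState_succ] at hk0⟩

theorem permCanWin_iff_groupCanWin {S : Set (Equiv.Perm (Fin n))} (hS : 1 ∈ S) :
    PermCanWin S m ↔ GroupCanWin (Fin n → ZMod m) S := by
  constructor
  · rintro ⟨N, y, h⟩
    exact ⟨_, fun s => (forces_ofFn_iff hS N y s).2 (h s)⟩
  · rintro ⟨l, h⟩
    refine ⟨l.length, fun k => l.getD k 0, fun s => (forces_ofFn_iff hS _ _ s).1 ?_⟩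
    simpa using h s

theorem PermCanWin.eq_of_prime_dvd [NeZero m] {S : Set (Equiv.Perm (Fin n))} (hS : 1 ∈ S)
    (h : PermCanWin S m) {p q : ℕ} (hp : p.Prime) (hq : q.Prime) (hpm : p ∣ m)
    (hqG : q ∣ Nat.card (Subgroup.closure S)) : q = p := by
  by_contra hqp
  have := Fact.mk hq
  obtain ⟨g, hg⟩ := exists_prime_orderOf_dvd_card' q hqG
  have hgq : (g : Equiv.Perm (Fin n)) ^ q = 1 := by
    rw [← Subgroup.coe_pow, ← hg, pow_orderOf_eq_one, Subgroup.coe_one]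
  obtain ⟨d, rfl⟩ := hpm
  have hd : (d : ZMod (p * d)) ≠ 0 := by
    rw [Ne, ZMod.natCast_eq_zero_iff]
    intro hdvd
    have hd0 : 0 < d := Nat.pos_of_ne_zero fun h0 => NeZero.ne (p * d) (by simp [h0])
    have := Nat.le_of_dvd hd0 hdvd
    nlinarith [hp.two_le]
  refine hq.one_lt.ne' (hg.symm.trans (orderOf_eq_one_iff.2 (Subtype.ext (Equiv.ext fun i => ?_))))
  have hfix := ((permCanWin_iff_groupCanWin hS).1 h).smul_eq_of_coprime hS
    ((Nat.coprime_primes hp hq).2 (Ne.symm hqp)) g.2 hgq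
    (x := Pi.single i (d : ZMod (p * d))) (by
      rw [← Pi.single_smul, nsmul_eq_mul, ← Nat.cast_mul, ZMod.natCast_self, Pi.single_zero])
  have hgi := congrFun hfix ((g : Equiv.Perm (Fin n)) i)
  change (Pi.single i d : Fin n → ZMod (p * d)) (g.1.symm (g.1 i)) = _ at hgi
  rw [Equiv.symm_apply_apply, Pi.single_eq_same] at hgi
  by_contra hne
  exact hd (hgi.trans (Pi.single_eq_of_ne hne _))

end PermGame

theorem permutation_game_characterization (n m : ℕ) (hn : 1 ≤ n) (hm : 1 ≤ m)
    (S : Set (Equiv.Perm (Fin n))) (hS : (1 : Equiv.Perm (Fin n)) ∈ S) :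
    PermCanWin S m ↔
      Nat.card (Subgroup.closure S) = 1 ∨ m = 1 ∨
        ∃ p a b : ℕ, p.Prime ∧ 0 < a ∧ 0 < b ∧
          Nat.card (Subgroup.closure S) = p ^ a ∧ m = p ^ b := by
  have : NeZero m := ⟨by lia⟩
  constructor
  · intro h
    rw [or_iff_not_imp_left, or_iff_not_imp_left]
    intro hG hm1
    obtain ⟨p, hp, hpm⟩ := Nat.exists_prime_and_dvd hm1
    obtain ⟨q, hq, hqG⟩ := Nat.exists_prime_and_dvd hG
    have hqp : q = p := h.eq_of_prime_dvd hS hp hq hpm hqG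
    have hGp := Nat.eq_prime_pow_of_unique_prime_dvd (p := p) Nat.card_pos.ne'
      fun hr hrG => h.eq_of_prime_dvd hS hp hr hpm hrG
    have hmp := Nat.eq_prime_pow_of_unique_prime_dvd (p := p) (NeZero.ne m)
      fun hr hrm => (h.eq_of_prime_dvd hS hr hq hrm hqG).symm.trans hqp
    refine ⟨p, _, _, hp, Nat.pos_of_ne_zero fun h0 => hG ?_, Nat.pos_of_ne_zero fun h0 => hm1 ?_,
      hGp, hmp⟩
    · rw [hGp, h0, pow_zero]
    · rw [hmp, h0, pow_zero]
  · let _ := permAction n m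
    intro h
    rw [permCanWin_iff_groupCanWin hS]
    obtain hG | rfl | ⟨p, a, b, hp, -, -, hG, rfl⟩ := h
    · refine (groupCanWin_iff hS).2 fun A _ hA => ?_
      obtain ⟨x, hx⟩ : ∃ x, x ∉ A := by
        by_contra! hx
        exact hA ((AddSubgroup.eq_top_iff' A).2 hx)
      rw [Subgroup.card_eq_one, Subgroup.closure_eq_bot_iff] at hG
      refine ⟨x, hx, fun g hg => ?_⟩
      rw [hG hg, one_smul, sub_self]
      exact A.zero_mem
    · exact ⟨[], fun s => Subsingleton.elim s 0⟩
    · have := Fact.mk hp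
      refine (groupCanWin_of_isPGroup (p := p) (Subgroup.closure S) (IsPGroup.of_card hG)
        (IsPGroup.of_card (n := b * n) ?_)).mono Subgroup.subset_closure
      simp [pow_mul]
end

section
/- Let n ≥ 1, m ≥ 1, let S be a set of permutations of Fin n containing the identity, and let G be the subgroup of the symmetric group on Fin n generated by S. If the player can win the (S, m)-game, then |G| = 1, or m = 1, or there exist a prime p and positive integers a, b with |G| = p^a and m = p^b. -/
/-- The representation of the symmetric group on `Fin n` by permutation of coordinates. -/
def coordRep (R : Type*) [CommRing R] (n : ℕ) :
    Representation R (Equiv.Perm (Fin n)) (Fin n → R) where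
  toFun σ := LinearMap.funLeft R R ⇑(σ⁻¹)
  map_one' := by
    ext v i
    simp [LinearMap.funLeft_apply]
  map_mul' σ τ := by
    refine LinearMap.ext fun v => funext fun i => ?_
    simp [LinearMap.funLeft_apply]

theorem coordRep_apply {R : Type*} [CommRing R] {n : ℕ} (σ : Equiv.Perm (Fin n))
    (v : Fin n → R) (i : Fin n) : coordRep R n σ v i = v (σ⁻¹ i) := rfl

theorem coordRep_injective (R : Type*) [CommRing R] [Nontrivial R] (n : ℕ) :
    Function.Injective (coordRep R n) := by
  intro σ τ h
  have hinv : σ⁻¹ = τ⁻¹ := by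
    ext1 i
    have hi := congrFun (LinearMap.congr_fun h (Pi.single (σ⁻¹ i) 1)) i
    rw [coordRep_apply, coordRep_apply, Pi.single_eq_same] at hi
    by_contra hne
    rw [Pi.single_eq_of_ne (Ne.symm hne)] at hi
    exact one_ne_zero hi
  exact inv_injective hinv

section Unipotent

variable {R G V : Type*} [CommRing R] [Group G] [AddCommGroup V] [Module R V]

/-- The vectors generated from `0` by adjoining every vector that is fixed by the subgroup `H`
modulo the vectors already obtained. -/
inductive IsUnipotentVector (ρ : Representation R G V) (H : Subgroup G) : V → Prop
  | zero : IsUnipotentVector ρ H 0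
  | step (v : V) (h : ∀ g ∈ H, IsUnipotentVector ρ H (ρ g v - v)) : IsUnipotentVector ρ H v

namespace IsUnipotentVector

variable {ρ : Representation R G V} {H : Subgroup G}

theorem sub_mem {v : V} (hv : IsUnipotentVector ρ H v) {g : G} (hg : g ∈ H) :
    IsUnipotentVector ρ H (ρ g v - v) := by
  cases hv with
  | zero => simpa using zero
  | step _ h => exact h g hg

theorem add {v w : V} (hv : IsUnipotentVector ρ H v) (hw : IsUnipotentVector ρ H w) :
    IsUnipotentVector ρ H (v + w) := by
  induction hv generalizing w with
  | zero => simpa using hw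
  | step v _ ih =>
    refine step _ fun g hg => ?_
    have := ih g hg (hw.sub_mem hg)
    rwa [map_add, add_sub_add_comm]

theorem neg {v : V} (hv : IsUnipotentVector ρ H v) : IsUnipotentVector ρ H (-v) := by
  induction hv with
  | zero => simpa using zero
  | step v _ ih =>
    refine step _ fun g hg => ?_
    have := ih g hg
    rwa [map_neg, ← neg_sub']

theorem sub {v w : V} (hv : IsUnipotentVector ρ H v) (hw : IsUnipotentVector ρ H w) :
    IsUnipotentVector ρ H (v - w) := by
  rw [sub_eq_add_neg]
  exact hv.add hw.neg

theorem map {v : V} (hv : IsUnipotentVector ρ H v) {g : G} (hg : g ∈ H) :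
    IsUnipotentVector ρ H (ρ g v) := by
  rw [← sub_add_cancel (ρ g v) v]
  exact (hv.sub_mem hg).add hv

/-- A vector on which the generators of `H` act trivially modulo unipotent vectors is
unipotent. -/
theorem of_generators {S : Set G} {v : V}
    (h : ∀ σ ∈ S, IsUnipotentVector ρ (Subgroup.closure S) (ρ σ⁻¹ v - v)) :
    IsUnipotentVector ρ (Subgroup.closure S) v := by
  have key (g : G) (hg : g ∈ Subgroup.closure S)
      (hv : IsUnipotentVector ρ (Subgroup.closure S) (ρ g v - v)) :
      IsUnipotentVector ρ (Subgroup.closure S) (ρ g⁻¹ v - v) := by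
    have := (hv.map (inv_mem hg)).neg
    rwa [map_sub, ρ.inv_self_apply, neg_sub] at this
  refine step v fun g hg => ?_
  induction hg using Subgroup.closure_induction with
  | mem σ hσ =>
    have := key σ⁻¹ (inv_mem (Subgroup.subset_closure hσ)) (h σ hσ)
    rwa [inv_inv] at this
  | one => simpa using zero
  | mul g k hg _ ihg ihk =>
    have := (ihk.map hg).add ihg
    rwa [map_sub, sub_add_sub_cancel, ← Module.End.mul_apply, ← map_mul] at this
  | inv g hg ih => exact key g hg ih

theorem exists_pow_apply_eq_zero {v : V} (hv : IsUnipotentVector ρ H v) {g : G} (hg : g ∈ H) :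
    ∃ k : ℕ, ((ρ g - 1) ^ k) v = 0 := by
  induction hv with
  | zero => exact ⟨0, map_zero _⟩
  | step v _ ih =>
    obtain ⟨k, hk⟩ := ih g hg
    exact ⟨k + 1, by rw [pow_succ]; exact hk⟩

end IsUnipotentVector

/-- A group element acting unipotently in characteristic `p` acts with `p`-power order. -/
theorem exists_pow_prime_pow_eq_one_of_isUnipotentVector [Finite V] (p : ℕ) [Fact p.Prime]
    [CharP R p] {ρ : Representation R G V} {H : Subgroup G}
    (h : ∀ v, IsUnipotentVector ρ H v) {g : G} (hg : g ∈ H) :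
    ∃ j : ℕ, ρ g ^ p ^ j = 1 := by
  choose k hk using fun v => (h v).exists_pow_apply_eq_zero hg
  obtain ⟨K, hK⟩ := Set.finite_range k |>.bddAbove
  have hj : K ≤ p ^ K := (Nat.lt_pow_self (Fact.out : p.Prime).one_lt).le
  refine ⟨K, LinearMap.ext fun v => ?_⟩
  have hp : (p : Module.End R V) = 0 := by
    ext v
    rw [← map_natCast (algebraMap R (Module.End R V)), CharP.cast_eq_zero, map_zero]
  obtain ⟨d, hd⟩ := Nat.exists_eq_add_of_le' ((hK ⟨v, rfl⟩).trans hj)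
  have hv : ((ρ g - 1) ^ p ^ K) v = 0 := by
    rw [hd, pow_add, Module.End.mul_apply, hk, map_zero]
  rcases subsingleton_or_nontrivial (Module.End R V) with hs | hn
  · rw [Subsingleton.elim (ρ g ^ p ^ K) 1]
  · have : CharP (Module.End R V) p :=
      (CharP.charP_iff_prime_eq_zero Fact.out).mpr hp
    rw [sub_pow_char_pow_of_commute p _ (Commute.one_right (ρ g)), one_pow,
      LinearMap.sub_apply, sub_eq_zero] at hv
    exact hv

end Unipotent

theorem permState_succ_eq {n m : ℕ} (y : ℕ → Fin n → ZMod m) (σ : ℕ → Equiv.Perm (Fin n))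
    (s : Fin n → ZMod m) (k : ℕ) :
    permState y σ s (k + 1) = permState (fun j => y (j + 1)) (fun j => σ (j + 1))
      (coordRep (ZMod m) n (σ 0) (s + y 0)) k := by
  induction k with
  | zero => rfl
  | succ k ih =>
    rw [permState, ih, permState]

/-- If some configuration is not unipotent, the adversary can avoid unipotent configurations
for any number of turns. -/
theorem exists_permState_not_isUnipotentVector {n m : ℕ} {S : Set (Equiv.Perm (Fin n))}
    (hS : (1 : Equiv.Perm (Fin n)) ∈ S) {v : Fin n → ZMod m}
    (hv : ¬ IsUnipotentVector (coordRep (ZMod m) n) (Subgroup.closure S) v)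
    (N : ℕ) (y : ℕ → Fin n → ZMod m) :
    ∃ (s : Fin n → ZMod m) (σ : ℕ → Equiv.Perm (Fin n)), (∀ k, σ k ∈ S) ∧
      ∀ k ≤ N, ¬ IsUnipotentVector (coordRep (ZMod m) n) (Subgroup.closure S)
        (permState y σ s k) := by
  induction N generalizing y with
  | zero =>
    refine ⟨v, fun _ => 1, fun _ => hS, fun k hk => ?_⟩
    obtain rfl := Nat.le_zero.mp hk
    exact hv
  | succ N ih =>
    obtain ⟨s, σ, hσ, hs⟩ := ih fun j => y (j + 1)
    obtain ⟨τ, hτ, hτs⟩ : ∃ τ ∈ S, ¬ IsUnipotentVector (coordRep (ZMod m) n)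
        (Subgroup.closure S) (coordRep (ZMod m) n τ⁻¹ s - y 0) := by
      by_contra! hcon
      refine hs 0 N.zero_le (IsUnipotentVector.of_generators fun τ hτ => ?_)
      have h1 := hcon 1 hS
      rw [inv_one, map_one, Module.End.one_apply] at h1
      simpa only [sub_sub_sub_cancel_right, permState] using (hcon τ hτ).sub h1
    refine ⟨coordRep (ZMod m) n τ⁻¹ s - y 0, fun k => Nat.casesOn k τ σ, ?_, ?_⟩
    · rintro (_ | k)
      exacts [hτ, hσ k]
    · rintro (_ | k) hk
      · exact hτs
      · rw [permState_succ_eq]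
        simpa using hs k (Nat.le_of_succ_le_succ hk)

theorem PermCanWin.isUnipotentVector {n m : ℕ} {S : Set (Equiv.Perm (Fin n))}
    (hS : (1 : Equiv.Perm (Fin n)) ∈ S) (h : PermCanWin S m) (v : Fin n → ZMod m) :
    IsUnipotentVector (coordRep (ZMod m) n) (Subgroup.closure S) v := by
  by_contra hv
  obtain ⟨N, y, hy⟩ := h
  obtain ⟨s, σ, hσ, hs⟩ := exists_permState_not_isUnipotentVector hS hv N y
  obtain ⟨k, hk, h0⟩ := hy s σ hσ
  exact hs k hk (h0 ▸ IsUnipotentVector.zero)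

theorem PermCanWin.of_dvd {n m d : ℕ} {S : Set (Equiv.Perm (Fin n))} (hd : d ∣ m)
    (h : PermCanWin S m) : PermCanWin S d := by
  obtain ⟨N, y, hy⟩ := h
  refine ⟨N, fun k i => ZMod.castHom hd (ZMod d) (y k i), fun s σ hσ => ?_⟩
  choose t ht using fun i => ZMod.castHom_surjective hd (s i)
  obtain ⟨k, hk, h0⟩ := hy t σ hσ
  have hstate : ∀ k, permState (fun k i => ZMod.castHom hd (ZMod d) (y k i)) σ s k =
      fun i => ZMod.castHom hd (ZMod d) (permState y σ t k i) := by
    intro k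
    induction k with
    | zero => exact funext fun i => (ht i).symm
    | succ k ih =>
      funext i
      simp only [permState, ih, Pi.add_apply, map_add]
  refine ⟨k, hk, ?_⟩
  rw [hstate, h0]
  exact funext fun i => map_zero _

theorem PermCanWin.isPGroup {n p : ℕ} [Fact p.Prime] {S : Set (Equiv.Perm (Fin n))}
    (hS : (1 : Equiv.Perm (Fin n)) ∈ S) (h : PermCanWin S p) :
    IsPGroup p (Subgroup.closure S) := by
  rintro ⟨g, hg⟩
  obtain ⟨j, hj⟩ := exists_pow_prime_pow_eq_one_of_isUnipotentVector p
    (h.isUnipotentVector hS) hg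
  refine ⟨j, Subtype.ext (coordRep_injective (ZMod p) n ?_)⟩
  simpa using hj

theorem permutation_game_only_if (n m : ℕ) (hn : 1 ≤ n) (hm : 1 ≤ m)
    (S : Set (Equiv.Perm (Fin n))) (hS : (1 : Equiv.Perm (Fin n)) ∈ S)
    (h : PermCanWin S m) :
    Nat.card (Subgroup.closure S) = 1 ∨ m = 1 ∨
      ∃ p a b : ℕ, p.Prime ∧ 0 < a ∧ 0 < b ∧
        Nat.card (Subgroup.closure S) = p ^ a ∧ m = p ^ b := by
  have hcard (q : ℕ) (hq : q.Prime) (hqm : q ∣ m) :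
      ∃ a, Nat.card (Subgroup.closure S) = q ^ a := by
    have : Fact q.Prime := ⟨hq⟩
    exact IsPGroup.iff_card.mp ((h.of_dvd hqm).isPGroup hS)
  by_cases hG : Nat.card (Subgroup.closure S) = 1
  · exact Or.inl hG
  by_cases hm1 : m = 1
  · exact Or.inr (Or.inl hm1)
  obtain ⟨p, hp, hpm⟩ := Nat.exists_prime_and_dvd hm1
  obtain ⟨a, ha⟩ := hcard p hp hpm
  have hmp : m = p ^ m.primeFactorsList.length := by
    refine Nat.eq_prime_pow_of_unique_prime_dvd (by omega) fun {q} hq hqm => ?_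
    obtain ⟨c, hc⟩ := hcard q hq hqm
    obtain ⟨r, hr, hrG⟩ := Nat.exists_prime_and_dvd hG
    have hrp := (Nat.prime_dvd_prime_iff_eq hr hp).mp (hr.dvd_of_dvd_pow (ha ▸ hrG))
    have hrq := (Nat.prime_dvd_prime_iff_eq hr hq).mp (hr.dvd_of_dvd_pow (hc ▸ hrG))
    exact hrq.symm.trans hrp
  refine Or.inr (Or.inr ⟨p, a, _, hp, ?_, ?_, ha, hmp⟩)
  · refine Nat.pos_of_ne_zero fun h0 => hG ?_
    rw [ha, h0, pow_zero]
  · refine Nat.pos_of_ne_zero fun h0 => hm1 ?_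
    rw [hmp, h0, pow_zero]
end
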